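/- Consider the game Γ_ex as an infinite-horizon discounted Markov game with discount factor γ = 2/3 and initial distribution ρ uniform over {s₁, s₂, s₃}. The marginal product policy π^σ of σ (players 1 and 2 each play their two actions uniformly at random in every state, independently) satisfies V^{π^σ}_1(ρ) = −3/10, while the deviation of player 1 to the deterministic stationary policy that always plays a₂ yields value −1/6. Consequently, π^σ is not an ε-approximate NE for any ε < 2/15; in particular π^σ is not a Nash equilibrium. -/

import Mathlib

open Finset

section InfiniteHorizon

variable {n : ℕ} {S : Type*} [Fintype S] [DecidableEq S] {A : Fin n → Type*}
  [∀ k, Fintype (A k)] [∀ k, DecidableEq (A k)]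

/-- `f` is a probability distribution on the finite type `α`. -/
def IsDist {α : Type*} [Fintype α] (f : α → ℝ) : Prop :=
  (∀ x, 0 ≤ f x) ∧ ∑ x, f x = 1

/-- A stationary Markov policy: a distribution on `α` for every state. -/
def IsStatPol {S : Type*} {α : Type*} [Fintype α] (π : S → α → ℝ) : Prop :=
  ∀ s : S, IsDist (π s)

/-- A valid (stationary) transition kernel. -/
def IsKer (P : S → (∀ k, A k) → S → ℝ) : Prop :=
  ∀ s a, IsDist (P s a)

/-- Rewards take values in `[-1, 1]`. -/
def IsRew (r : Fin n → S → (∀ k, A k) → ℝ) : Prop :=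
  ∀ k s a, r k s a ∈ Set.Icc (-1 : ℝ) 1

/-- `h`-step state-to-state transition matrix under the joint policy `σ`. -/
noncomputable def matPow (P : S → (∀ k, A k) → S → ℝ)
    (σ : S → (∀ k, A k) → ℝ) : ℕ → S → S → ℝ
  | 0 => fun s s' => if s = s' then 1 else 0
  | h + 1 => fun s s' => ∑ t, matPow P σ h s t * ∑ a, σ t a * P t a s'

/-- Expected one-step reward under `σ`. -/
noncomputable def expRew (σ : S → (∀ k, A k) → ℝ)
    (rk : S → (∀ k, A k) → ℝ) (s : S) : ℝ :=
  ∑ a, σ s a * rk s a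

/-- `vinf γ P rk σ s` is the expected `γ`-discounted infinite-horizon reward
`V^σ(s) = E[∑ₕ γ^(h-1) r(s_h, a_h)]`, started at state `s`. -/
noncomputable def vinf (γ : ℝ) (P : S → (∀ k, A k) → S → ℝ)
    (rk : S → (∀ k, A k) → ℝ) (σ : S → (∀ k, A k) → ℝ) (s : S) : ℝ :=
  ∑' h : ℕ, γ ^ h * ∑ s', matPow P σ h s s' * expRew σ rk s'

/-- Value under the initial distribution `ρ`. -/
noncomputable def vinfρ (γ : ℝ) (P : S → (∀ k, A k) → S → ℝ)
    (rk : S → (∀ k, A k) → ℝ) (σ : S → (∀ k, A k) → ℝ) (ρ : S → ℝ) : ℝ :=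
  ∑ s, ρ s * vinf γ P rk σ s

/-- The joint stationary policy in which player `k` plays `π'` independently
against the marginal `σ₋ₖ` of the joint policy `σ`. -/
noncomputable def deviateI (k : Fin n) (π' : S → A k → ℝ)
    (σ : S → (∀ j, A j) → ℝ) : S → (∀ j, A j) → ℝ :=
  fun s a => π' s (a k) * ∑ b : A k, σ s (Function.update a k b)

/-- The marginal stationary policy of player `k` induced by `σ`. -/
noncomputable def marginalI (σ : S → (∀ j, A j) → ℝ) (k : Fin n) :
    S → A k → ℝ :=
  fun s b => ∑ a : ∀ j, A j, if a k = b then σ s a else 0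

/-- The product policy induced by individual stationary policies `π k`. -/
def prodPolI (π : ∀ k, S → A k → ℝ) : S → (∀ j, A j) → ℝ :=
  fun s a => ∏ k, π k s (a k)

/-- `σ` is an `ε`-approximate CCE of the discounted game (w.r.t. `ρ`). -/
def IsCCEI (γ : ℝ) (P : S → (∀ k, A k) → S → ℝ)
    (r : Fin n → S → (∀ k, A k) → ℝ) (ρ : S → ℝ) (ε : ℝ)
    (σ : S → (∀ k, A k) → ℝ) : Prop :=
  ∀ k : Fin n, ∀ π' : S → A k → ℝ, IsStatPol π' →
    vinfρ γ P (r k) (deviateI k π' σ) ρ - vinfρ γ P (r k) σ ρ ≤ ε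

/-- The stationary product policy `π` is an `ε`-approximate NE (w.r.t. `ρ`). -/
def IsNEI (γ : ℝ) (P : S → (∀ k, A k) → S → ℝ)
    (r : Fin n → S → (∀ k, A k) → ℝ) (ρ : S → ℝ) (ε : ℝ)
    (π : ∀ k, S → A k → ℝ) : Prop :=
  ∀ k : Fin n, ∀ π' : S → A k → ℝ, IsStatPol π' →
    vinfρ γ P (r k) (deviateI k π' (prodPolI π)) ρ -
      vinfρ γ P (r k) (prodPolI π) ρ ≤ ε

/-- `v` is the best-response value `V^{†,σ₋ₖ}_k(s)` of player `k` against `σ`. -/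
def IsBRValI (γ : ℝ) (P : S → (∀ k, A k) → S → ℝ)
    (rk : S → (∀ k, A k) → ℝ) (σ : S → (∀ k, A k) → ℝ)
    (k : Fin n) (s : S) (v : ℝ) : Prop :=
  IsGreatest {x : ℝ | ∃ π' : S → A k → ℝ, IsStatPol π' ∧
    x = vinf γ P rk (deviateI k π' σ) s} v

/-- The game is zero-sum polymatrix. -/
def IsZSPolymatrixI (r : Fin n → S → (∀ k, A k) → ℝ) : Prop :=
  (∀ s a, ∑ k, r k s a = 0) ∧
  ∃ q : (k : Fin n) → (j : Fin n) → S → A k → A j → ℝ,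
    (∀ k j s x y, q k j s x y ∈ Set.Icc (-1 : ℝ) 1) ∧
    ∀ k s a, r k s a = ∑ j ∈ univ.filter (fun j => j ≠ k), q k j s (a k) (a j)

/-- Switching control: at every state a single player controls the transition. -/
def SwitchingControlI (P : S → (∀ k, A k) → S → ℝ) : Prop :=
  ∀ s : S, ∃ k : Fin n, ∀ a a' : ∀ j, A j, a k = a' k → P s a = P s a'

/-- Feasibility for the nonlinear program `P_NE'`. -/
def FeasNEI (γ : ℝ) (P : S → (∀ k, A k) → S → ℝ)
    (r : Fin n → S → (∀ k, A k) → ℝ)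
    (π : ∀ k, S → A k → ℝ) (w : Fin n → S → ℝ) : Prop :=
  (∀ k, IsStatPol (π k)) ∧
  ∀ k : Fin n, ∀ s, ∀ b : A k,
    (∑ a : ∀ j, A j, if a k = b then
        (∏ j ∈ univ.filter (fun j => j ≠ k), π j s (a j)) *
          (r k s a + γ * ∑ s', P s a s' * w k s')
      else 0) ≤ w k s

/-- Objective of the nonlinear program `P_NE'`. -/
noncomputable def objNEI (γ : ℝ) (P : S → (∀ k, A k) → S → ℝ)
    (r : Fin n → S → (∀ k, A k) → ℝ) (ρ : S → ℝ)
    (π : ∀ k, S → A k → ℝ) (w : Fin n → S → ℝ) : ℝ :=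
  ∑ k, ∑ s, ρ s * (w k s - vinf γ P (r k) (prodPolI π) s)

/-- Feasibility for the best-response linear program `P_BR'(σ̂)`. -/
def FeasBRI (γ : ℝ) (P : S → (∀ k, A k) → S → ℝ)
    (r : Fin n → S → (∀ k, A k) → ℝ)
    (σ' : S → (∀ k, A k) → ℝ) (w : Fin n → S → ℝ) : Prop :=
  ∀ k : Fin n, ∀ s, ∀ b : A k,
    (∑ a : ∀ j, A j, if a k = b then
        (∑ b' : A k, σ' s (Function.update a k b')) *
          (r k s a + γ * ∑ s', P s a s' * w k s')
      else 0) ≤ w k s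

/-- Objective of the best-response linear program `P_BR'(σ̂)`. -/
noncomputable def objBRI (γ : ℝ) (P : S → (∀ k, A k) → S → ℝ)
    (r : Fin n → S → (∀ k, A k) → ℝ) (ρ : S → ℝ)
    (σ' : S → (∀ k, A k) → ℝ) (w : Fin n → S → ℝ) : ℝ :=
  ∑ k, ∑ s, ρ s * (w k s - vinf γ P (r k) σ' s)

end InfiniteHorizon
section ExampleIH

/-- States of the example game: `0 = s₁`, `1 = s₂`, `2 = s₃`. -/
abbrev Sex : Type := Fin 3

/-- Action sets: players `0` and `1` have two actions (`0 = a₁/b₁`,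
`1 = a₂/b₂`), player `2` has a single action. -/
abbrev Aex : Fin 3 → Type := fun k => Fin (![2, 2, 1] k)

/-- Reward of player 1 (index 0). -/
noncomputable def r1ex (s : Sex) (a : ∀ k, Aex k) : ℝ :=
  if s = 2 then -(1 / 2) else if (a 0).val = 0 then 1 / 20 else 0

/-- Reward of player 2 (index 1). -/
noncomputable def r2ex (s : Sex) (a : ∀ k, Aex k) : ℝ :=
  if s = 2 then -(1 / 2) else if (a 1).val = 0 then 1 / 20 else 0

/-- Rewards of the example game. -/
noncomputable def rexI : Fin 3 → Sex → (∀ k, Aex k) → ℝ :=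
  fun k s a =>
    if k = 0 then r1ex s a
    else if k = 1 then r2ex s a
    else -(r1ex s a + r2ex s a)

/-- Transitions of the example game. -/
noncomputable def PexI : Sex → (∀ k, Aex k) → Sex → ℝ :=
  fun s a s' =>
    if s = 2 then (if s' = 2 then 0 else 1 / 2)
    else if (a 0).val = 0 ∧ (a 1).val = 0 then (if s' = 2 then 1 else 0)
    else if s = 0 then (if s' = 1 then 1 else 0)
    else (if s' = 0 then 1 else 0)

/-- The correlated stationary policy `σ`: in every state, the joint actions
`(a₁, b₂)` and `(a₂, b₁)` are played with probability `1/2` each. -/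
noncomputable def σexI : Sex → (∀ k, Aex k) → ℝ :=
  fun _ a => if (a 0).val ≠ (a 1).val then 1 / 2 else 0

/-- The deterministic stationary policy of player 1 that always plays `a₂`. -/
noncomputable def devexI : Sex → Aex 0 → ℝ :=
  fun _ b => if b.val = 1 then 1 else 0

/-- The uniform initial distribution over the three states. -/
noncomputable def ρex : Sex → ℝ := fun _ => 1 / 3

end ExampleIH

section BellmanEvaluation

variable {n : ℕ} {S : Type*} [Fintype S] {A : Fin n → Type*} [∀ k, Fintype (A k)]

/-- State-to-state transition probabilities under the joint policy `σ` are distributions. -/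
theorem isDist_step {P : S → (∀ k, A k) → S → ℝ} {σ : S → (∀ k, A k) → ℝ}
    (hP : IsKer P) (hσ : IsStatPol σ) (t : S) :
    IsDist (fun s' => ∑ a, σ t a * P t a s') := by
  refine ⟨fun s' => sum_nonneg fun a _ => mul_nonneg ((hσ t).1 a) ((hP t a).1 s'), ?_⟩
  rw [sum_comm]
  simp_rw [← mul_sum, (hP t _).2, mul_one]
  exact (hσ t).2

variable [DecidableEq S]

/-- The rows of the `h`-step transition matrix are distributions. -/
theorem isDist_matPow {P : S → (∀ k, A k) → S → ℝ} {σ : S → (∀ k, A k) → ℝ}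
    (hP : IsKer P) (hσ : IsStatPol σ) (h : ℕ) (s : S) : IsDist (matPow P σ h s) := by
  induction h with
  | zero =>
    refine ⟨fun s' => ?_, by simp [matPow]⟩
    simp only [matPow]
    split_ifs <;> norm_num
  | succ h ih =>
    refine ⟨fun s' => sum_nonneg fun t _ =>
      mul_nonneg (ih.1 t) ((isDist_step hP hσ t).1 s'), ?_⟩
    simp only [matPow]
    rw [sum_comm]
    simp_rw [← mul_sum, (isDist_step hP hσ _).2, mul_one]
    exact ih.2

/-- A solution of the Bellman evaluation equation is the discounted value function. -/
theorem vinf_eq_of_bellman {γ : ℝ} (hγ₀ : 0 ≤ γ) (hγ₁ : γ < 1)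
    {P : S → (∀ k, A k) → S → ℝ} {σ : S → (∀ k, A k) → ℝ} {rk : S → (∀ k, A k) → ℝ}
    (hP : IsKer P) (hσ : IsStatPol σ) {w : S → ℝ}
    (hw : ∀ t, w t = expRew σ rk t + γ * ∑ s', (∑ a, σ t a * P t a s') * w s') (s : S) :
    vinf γ P rk σ s = w s := by
  set g : ℕ → ℝ := fun h => γ ^ h * ∑ s', matPow P σ h s s' * w s' with hg
  have hstep (h : ℕ) : γ ^ h * ∑ s', matPow P σ h s s' * expRew σ rk s' = g h - g (h + 1) := by
    have hsucc : ∑ s', matPow P σ (h + 1) s s' * w s' =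
        ∑ t, matPow P σ h s t * ∑ s', (∑ a, σ t a * P t a s') * w s' := by
      simp only [matPow, sum_mul, mul_sum]
      rw [sum_comm]
      simp only [mul_assoc]
    simp only [hg]
    rw [hsucc, pow_succ, mul_assoc, ← mul_sub]
    congr 1
    rw [mul_sum, ← sum_sub_distrib]
    refine sum_congr rfl fun t _ => ?_
    linear_combination -matPow P σ h s t * hw t
  have hbound (h : ℕ) : ‖g h‖ ≤ γ ^ h * ∑ t, |w t| := by
    rw [hg, Real.norm_eq_abs, abs_mul, abs_of_nonneg (pow_nonneg hγ₀ h)]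
    gcongr
    refine (abs_sum_le_sum_abs _ _).trans (sum_le_sum fun t _ => ?_)
    have hd := isDist_matPow hP hσ h s
    rw [abs_mul, abs_of_nonneg (hd.1 t)]
    refine mul_le_of_le_one_left (abs_nonneg _) ?_
    rw [← hd.2]
    exact single_le_sum (fun i _ => hd.1 i) (mem_univ t)
  have hsum : Summable g :=
    .of_norm_bounded ((summable_geometric_of_lt_one hγ₀ hγ₁).mul_right _) hbound
  unfold vinf
  simp_rw [hstep]
  rw [hsum.tsum_sub ((summable_nat_add_iff 1).2 hsum), hsum.tsum_eq_zero_add]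
  simp [hg, matPow]

end BellmanEvaluation

section ExampleEvaluation

/-- The joint action in which players 1 and 2 play `x` and `y`. -/
def actEx (x y : Fin 2) : ∀ k, Aex k :=
  Fin.cons (α := Aex) x
    (Fin.cons (α := fun i => Aex i.succ) y
      (Fin.cons (α := fun i => Aex i.succ.succ) (0 : Fin 1) finZeroElim))

@[simp] theorem actEx_zero (x y : Fin 2) : actEx x y 0 = x := rfl

@[simp] theorem actEx_one (x y : Fin 2) : actEx x y 1 = y := rfl

theorem sum_actEx (f : (∀ k, Aex k) → ℝ) :
    ∑ a, f a = f (actEx 0 0) + f (actEx 0 1) + f (actEx 1 0) + f (actEx 1 1) := by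
  have huniv : (univ : Finset (∀ k, Aex k)) =
      {actEx 0 0, actEx 0 1, actEx 1 0, actEx 1 1} := by decide
  rw [huniv, sum_insert (by decide), sum_insert (by decide), sum_insert (by decide),
    sum_singleton]
  ring

theorem isKer_PexI : IsKer PexI := by
  intro s a
  refine ⟨fun s' => ?_, ?_⟩
  · unfold PexI
    split_ifs <;> norm_num
  · fin_cases s <;> simp only [PexI, Fin.sum_univ_three] <;> split_ifs <;> simp_all <;> norm_num

theorem prodPolI_marginalI_σexI (s : Sex) (a : ∀ k, Aex k) :
    prodPolI (fun k => marginalI σexI k) s a = 1 / 4 := by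
  have h0 (b : Aex 0) : marginalI σexI 0 s b = 1 / 2 := by
    rw [marginalI, sum_actEx]
    change Fin 2 at b
    change (if (0 : Fin 2) = b then σexI s (actEx 0 0) else 0) +
      (if (0 : Fin 2) = b then σexI s (actEx 0 1) else 0) +
      (if (1 : Fin 2) = b then σexI s (actEx 1 0) else 0) +
      (if (1 : Fin 2) = b then σexI s (actEx 1 1) else 0) = 1 / 2
    fin_cases b <;> simp [σexI]
  have h1 (b : Aex 1) : marginalI σexI 1 s b = 1 / 2 := by
    rw [marginalI, sum_actEx]
    change Fin 2 at b
    change (if (0 : Fin 2) = b then σexI s (actEx 0 0) else 0) +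
      (if (1 : Fin 2) = b then σexI s (actEx 0 1) else 0) +
      (if (0 : Fin 2) = b then σexI s (actEx 1 0) else 0) +
      (if (1 : Fin 2) = b then σexI s (actEx 1 1) else 0) = 1 / 2
    fin_cases b <;> simp [σexI]
  have h2 (b : Aex 2) : marginalI σexI 2 s b = 1 := by
    rw [marginalI, sum_actEx]
    change Fin 1 at b
    change (if (0 : Fin 1) = b then σexI s (actEx 0 0) else 0) +
      (if (0 : Fin 1) = b then σexI s (actEx 0 1) else 0) +
      (if (0 : Fin 1) = b then σexI s (actEx 1 0) else 0) +
      (if (0 : Fin 1) = b then σexI s (actEx 1 1) else 0) = 1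
    fin_cases b
    simp [σexI]
    norm_num
  rw [prodPolI, Fin.prod_univ_three, h0, h1, h2]
  norm_num

theorem deviateI_devexI (s : Sex) (a : ∀ k, Aex k) :
    deviateI 0 devexI (prodPolI fun k => marginalI σexI k) s a =
      if (a 0).val = 1 then 1 / 2 else 0 := by
  have hsum : ∑ _b : Aex 0, (1 / 4 : ℝ) = 1 / 2 := by
    change ∑ _b : Fin 2, (1 / 4 : ℝ) = 1 / 2
    norm_num
  simp only [deviateI, prodPolI_marginalI_σexI, hsum, devexI]
  split_ifs <;> norm_num

theorem isStatPol_devexI : IsStatPol devexI := by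
  intro s
  refine ⟨fun b => ?_, ?_⟩
  · unfold devexI
    split_ifs <;> norm_num
  · change ∑ b : Fin 2, (if b.val = 1 then (1 : ℝ) else 0) = 1
    rw [Fin.sum_univ_two]
    simp

theorem vinfρ_marginal :
    vinfρ (2 / 3) PexI (rexI 0) (prodPolI fun k => marginalI σexI k) ρex = -(3 / 10) := by
  have hσ : IsStatPol (prodPolI fun k => marginalI σexI k) := fun s => by
    refine ⟨fun a => ?_, ?_⟩
    · rw [prodPolI_marginalI_σexI]; norm_num
    · rw [sum_actEx]; simp only [prodPolI_marginalI_σexI]; norm_num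
  have hv := vinf_eq_of_bellman (γ := 2 / 3) (by norm_num) (by norm_num) isKer_PexI hσ
    (rk := rexI 0) (w := ![-(3 / 20), -(3 / 20), -(3 / 5)]) (by
      intro t
      simp only [expRew, sum_actEx, prodPolI_marginalI_σexI, Fin.sum_univ_three]
      fin_cases t <;> simp [rexI, r1ex, PexI] <;> norm_num)
  simp only [vinfρ, hv, ρex, Fin.sum_univ_three]
  simp
  norm_num

theorem vinfρ_deviation :
    vinfρ (2 / 3) PexI (rexI 0)
      (deviateI 0 devexI (prodPolI fun k => marginalI σexI k)) ρex = -(1 / 6) := by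
  have hσ : IsStatPol (deviateI 0 devexI (prodPolI fun k => marginalI σexI k)) := fun s => by
    refine ⟨fun a => ?_, ?_⟩
    · rw [deviateI_devexI]; split_ifs <;> norm_num
    · rw [sum_actEx]; simp [deviateI_devexI]; norm_num
  have hv := vinf_eq_of_bellman (γ := 2 / 3) (by norm_num) (by norm_num) isKer_PexI hσ
    (rk := rexI 0) (w := ![0, 0, -(1 / 2)]) (by
      intro t
      simp only [expRew, sum_actEx, deviateI_devexI, Fin.sum_univ_three]
      fin_cases t <;> simp [rexI, r1ex, PexI]
      norm_num)
  simp only [vinfρ, hv, ρex, Fin.sum_univ_three]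
  simp
  norm_num

end ExampleEvaluation

theorem example_marginal_not_NE_discounted :
    vinfρ (2 / 3) PexI (rexI 0) (prodPolI fun k => marginalI σexI k) ρex
        = -(3 / 10) ∧
    vinfρ (2 / 3) PexI (rexI 0)
        (deviateI 0 devexI (prodPolI fun k => marginalI σexI k)) ρex
        = -(1 / 6) ∧
    (∀ ε : ℝ, ε < 2 / 15 →
      ¬ IsNEI (2 / 3) PexI rexI ρex ε (fun k => marginalI σexI k)) ∧
    ¬ IsNEI (2 / 3) PexI rexI ρex 0 (fun k => marginalI σexI k) := by
  have hne (ε : ℝ) (hε : ε < 2 / 15) :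
      ¬ IsNEI (2 / 3) PexI rexI ρex ε (fun k => marginalI σexI k) := by
    intro h
    have hgap := h 0 devexI isStatPol_devexI
    rw [vinfρ_marginal, vinfρ_deviation] at hgap
    linarith
  exact ⟨vinfρ_marginal, vinfρ_deviation, hne, hne 0 (by norm_num)⟩
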